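/- Bilinear Morawetz identity for two NLS solutions (2.36)-(2.37): let h : ℝⁿ → ℝ be a smooth even function all of whose derivatives of order ≥ 1 are bounded, and let u₁, u₂ be two smooth decaying solutions of the same NLS equation, with ρ_i = |u_i|², j_i = Im(ū_i ∇u_i), g_i = g(ρ_i), G_i = G(ρ_i). Define M(t) = -(1/2)( ⟨ρ₁, ∇h ⋆ j₂⟩ + ⟨ρ₂, ∇h ⋆ j₁⟩ ). Then M'(t) = (1/2){ ⟨∇ρ₁, Δh ⋆ ∇ρ₂⟩ + ⟨ρ₁, Δh ⋆ (ρ₂g₂ - G₂)⟩ + ⟨ρ₂, Δh ⋆ (ρ₁g₁ - G₁)⟩ } + R(t), where R(t) = (1/2)∫∫ Σ_{k,l=1}^n ∂_k∂_l h(x-y) · conj(w_k(x,y)) · w_l(x,y) dx dy with w(x,y) = u₁(t,x)∇u₂(t,y) - u₂(t,y)∇u₁(t,x) ∈ ℂⁿ. Moreover, if ∇²h(z) is positive semidefinite for every z, then R(t) ≥ 0. -/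

import Mathlib

open MeasureTheory Filter Complex

noncomputable section

/-- `ℝⁿ` as a Euclidean space. -/
abbrev Ed (n : ℕ) := EuclideanSpace ℝ (Fin n)

/-- Spatial partial derivative `∂_k` of a complex-valued function. -/
def pd {n : ℕ} (k : Fin n) (f : Ed n → ℂ) (x : Ed n) : ℂ :=
  fderiv ℝ f x (EuclideanSpace.single k 1)

/-- Spatial partial derivative `∂_k` of a real-valued function. -/
def pdR {n : ℕ} (k : Fin n) (f : Ed n → ℝ) (x : Ed n) : ℝ :=
  fderiv ℝ f x (EuclideanSpace.single k 1)

/-- Spatial Laplacian of a complex-valued function. -/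
def lapC {n : ℕ} (f : Ed n → ℂ) (x : Ed n) : ℂ := ∑ k, pd k (fun y => pd k f y) x

/-- Spatial Laplacian of a real-valued function. -/
def lapR {n : ℕ} (f : Ed n → ℝ) (x : Ed n) : ℝ := ∑ k, pdR k (fun y => pdR k f y) x

/-- Second partial derivative `∂_k ∂_l h`. -/
def hess {n : ℕ} (h : Ed n → ℝ) (k l : Fin n) (x : Ed n) : ℝ :=
  pdR k (fun y => pdR l h y) x

/-- `u(t,·)` and all its space-time derivatives are Schwartz in `x`,
uniformly for `t` in compact intervals. -/
def SchwartzDecay {n : ℕ} (u : ℝ → Ed n → ℂ) : Prop :=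
  ∀ (N m : ℕ) (a b : ℝ), ∃ C : ℝ, ∀ t ∈ Set.Icc a b, ∀ x : Ed n,
    (1 + ‖x‖) ^ m * ‖iteratedFDeriv ℝ N (fun p : ℝ × Ed n => u p.1 p.2) (t, x)‖ ≤ C

/-- A smooth decaying solution of the NLS equation `i ∂_t u = -(1/2) Δu + g(|u|²) u`. -/
def IsNLSSolution {n : ℕ} (g : ℝ → ℝ) (u : ℝ → Ed n → ℂ) : Prop :=
  ContDiff ℝ (⊤ : ℕ∞) (fun p : ℝ × Ed n => u p.1 p.2) ∧ SchwartzDecay u ∧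
    ∀ t x, Complex.I * deriv (fun s => u s x) t =
      -(1/2) * lapC (u t) x + ((g (‖u t x‖ ^ 2) : ℝ) : ℂ) * u t x

/-- Mass density `ρ = |u|²`. -/
def dens {n : ℕ} (u : ℝ → Ed n → ℂ) (t : ℝ) (x : Ed n) : ℝ := ‖u t x‖ ^ 2

/-- Mass current `j = Im (ū ∇u)`, `k`-th component. -/
def curr {n : ℕ} (u : ℝ → Ed n → ℂ) (k : Fin n) (t : ℝ) (x : Ed n) : ℝ :=
  ((starRingEnd ℂ) (u t x) * pd k (u t) x).im

/-- The bilinear commutator vector `w(x,y) = u₁(t,x)∇u₂(t,y) - u₂(t,y)∇u₁(t,x)`. -/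
def wVec2 {n : ℕ} (u₁ u₂ : ℝ → Ed n → ℂ) (t : ℝ) (x y : Ed n) (k : Fin n) : ℂ :=
  u₁ t x * pd k (u₂ t) y - u₂ t y * pd k (u₁ t) x

/-- The bilinear remainder `R(t) = (1/2)∫∫ ∑_{k,l} ∂_k∂_l h(x-y) conj(w_k) w_l dx dy`. -/
def morawetzR2 {n : ℕ} (h : Ed n → ℝ) (u₁ u₂ : ℝ → Ed n → ℂ) (t : ℝ) : ℝ :=
  (1/2) * ∫ x, ∫ y,
    (∑ k, ∑ l, (hess h k l (x - y) : ℂ) *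
      ((starRingEnd ℂ) (wVec2 u₁ u₂ t x y k) * wVec2 u₁ u₂ t x y l)).re

/-- Directional derivative of `f` along the constant vector `v`, as a function of the base point. -/
def dirDeriv {E F : Type*} [NormedAddCommGroup E] [NormedSpace ℝ E] [NormedAddCommGroup F]
    [NormedSpace ℝ F] (v : E) (f : E → F) (x : E) : F :=
  fderiv ℝ f x v

section DirDeriv

variable {E F : Type*} [NormedAddCommGroup E] [NormedSpace ℝ E] [NormedAddCommGroup F]
  [NormedSpace ℝ F] {f : E → F}

lemma ContDiff.dirDeriv_top (hf : ContDiff ℝ (⊤ : ℕ∞) f) (v : E) :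
    ContDiff ℝ (⊤ : ℕ∞) (dirDeriv v f) :=
  (hf.fderiv_right (m := (⊤ : ℕ∞)) le_rfl).clm_apply contDiff_const

lemma ContDiff.dirDeriv_comm (hf : ContDiff ℝ (⊤ : ℕ∞) f) (v w : E) :
    dirDeriv v (dirDeriv w f) = dirDeriv w (dirDeriv v f) := by
  have hd : Differentiable ℝ (fderiv ℝ f) :=
    (hf.fderiv_right (m := (⊤ : ℕ∞)) le_rfl).differentiable (by simp)
  have key (v w : E) (x : E) : dirDeriv v (dirDeriv w f) x = fderiv ℝ (fderiv ℝ f) x v w :=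
    congrArg (fun L : E →L[ℝ] F => L v) ((hd x).hasFDerivAt.clm_apply
      (hasFDerivAt_const w x)).fderiv |>.trans (by simp)
  funext x
  rw [key, key]
  exact second_derivative_symmetric
    (fun y => (hf.differentiable (by simp) y).hasFDerivAt) (hd x).hasFDerivAt v w

lemma ContDiff.norm_iteratedFDeriv_dirDeriv_le (hf : ContDiff ℝ (⊤ : ℕ∞) f) (v : E) (i : ℕ)
    (x : E) :
    ‖iteratedFDeriv ℝ i (dirDeriv v f) x‖ ≤ ‖v‖ * ‖iteratedFDeriv ℝ (i + 1) f x‖ := by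
  have h1 : ContDiff ℝ (⊤ : ℕ∞) (fderiv ℝ f) := hf.fderiv_right (m := (⊤ : ℕ∞)) le_rfl
  have h2 := norm_iteratedFDeriv_clm_apply_const (c := v) (n := i) (h1.contDiffAt (x := x))
    (by exact_mod_cast le_top)
  rwa [norm_iteratedFDeriv_fderiv] at h2

end DirDeriv

/-- Smooth kernels that are bounded together with all their derivatives. -/
structure BddSmooth {n : ℕ} (K : Ed n → ℝ) : Prop where
  contDiff : ContDiff ℝ (⊤ : ℕ∞) K
  bound : ∀ i : ℕ, ∃ C : ℝ, ∀ x, ‖iteratedFDeriv ℝ i K x‖ ≤ C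

lemma bddSmooth_pdR_of_bound {n : ℕ} {h : Ed n → ℝ} (hs : ContDiff ℝ (⊤ : ℕ∞) h)
    (hb : ∀ i : ℕ, 1 ≤ i → ∃ C : ℝ, ∀ x, ‖iteratedFDeriv ℝ i h x‖ ≤ C) (k : Fin n) :
    BddSmooth (pdR k h) := by
  refine ⟨hs.dirDeriv_top _, fun i => ?_⟩
  obtain ⟨C, hC⟩ := hb (i + 1) (by omega)
  exact ⟨_, fun x => (hs.norm_iteratedFDeriv_dirDeriv_le _ i x).trans
    (mul_le_mul_of_nonneg_left (hC x) (norm_nonneg _))⟩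

lemma pdR_comm {n : ℕ} {h : Ed n → ℝ} (hs : ContDiff ℝ (⊤ : ℕ∞) h) (k l : Fin n) :
    pdR k (pdR l h) = pdR l (pdR k h) :=
  hs.dirDeriv_comm _ _

namespace BddSmooth

variable {n : ℕ} {K : Ed n → ℝ}

protected lemma pdR (hK : BddSmooth K) (k : Fin n) : BddSmooth (pdR k K) :=
  bddSmooth_pdR_of_bound hK.contDiff (fun i _ => hK.bound i) k

protected lemma differentiable (hK : BddSmooth K) : Differentiable ℝ K :=
  hK.contDiff.differentiable (by simp)

lemma exists_abs_le (hK : BddSmooth K) : ∃ C : ℝ, 0 ≤ C ∧ ∀ x, |K x| ≤ C := by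
  obtain ⟨C, hC⟩ := hK.bound 0
  simp only [norm_iteratedFDeriv_zero, Real.norm_eq_abs] at hC
  exact ⟨C, (abs_nonneg _).trans (hC 0), hC⟩

end BddSmooth

lemma pdR_comp_neg {n : ℕ} {h : Ed n → ℝ} (hd : Differentiable ℝ h) (k : Fin n) (x : Ed n) :
    pdR k (fun y => h (-y)) x = -pdR k h (-x) := by
  have h1 : HasFDerivAt (fun y : Ed n => h (-y)) _ x :=
    (hd (-x)).hasFDerivAt.comp x (hasFDerivAt_id x).neg
  simp only [pdR, h1.fderiv]
  simp

lemma hess_neg_of_even {n : ℕ} {h : Ed n → ℝ} (hs : ContDiff ℝ (⊤ : ℕ∞) h)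
    (he : ∀ x, h (-x) = h x) (k l : Fin n) (x : Ed n) : hess h k l (-x) = hess h k l x := by
  have h1 (y : Ed n) : pdR l h (-y) = -pdR l h y := by
    have := pdR_comp_neg (hs.differentiable (by simp)) l y
    simp only [he] at this
    rw [this, neg_neg]
  have h2 : pdR k (fun y => pdR l h (-y)) x = -pdR k (pdR l h) (-x) :=
    pdR_comp_neg ((hs.dirDeriv_top _).differentiable (by simp)) k x
  simp only [h1] at h2
  have h3 : pdR k (fun y => -pdR l h y) x = -pdR k (pdR l h) x := by
    simp only [pdR]
    rw [fderiv_fun_neg]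
    rfl
  rw [h3, neg_inj] at h2
  exact h2.symm

/-- The pairing `⟨f, K ⋆ g⟩` as an integral over the product space. -/
def pairing {n : ℕ} (K f g : Ed n → ℝ) : ℝ :=
  ∫ z : Ed n × Ed n, K (z.1 - z.2) * (f z.1 * g z.2)

/-- Differentiable functions that are integrable with integrable partial derivatives. -/
structure DiffIntegrable {n : ℕ} (f : Ed n → ℝ) : Prop where
  differentiable : Differentiable ℝ f
  integrable : Integrable f
  integrable_pdR : ∀ k, Integrable (pdR k f)

section Pairing

instance {n : ℕ} : (volume : Measure (Ed n × Ed n)).IsAddHaarMeasure :=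
  inferInstanceAs (Measure.prod volume volume).IsAddHaarMeasure

variable {n : ℕ} {K f g : Ed n → ℝ}

lemma integrable_pairing (hK : BddSmooth K) (hf : Integrable f) (hg : Integrable g) :
    Integrable (fun z : Ed n × Ed n => K (z.1 - z.2) * (f z.1 * g z.2)) := by
  obtain ⟨C, -, hC⟩ := hK.exists_abs_le
  have hc : Continuous K := hK.contDiff.continuous
  exact (hf.mul_prod hg).bdd_mul (c := C)
    (by fun_prop : Continuous fun z : Ed n × Ed n => K (z.1 - z.2)).aestronglyMeasurable
    (.of_forall fun z => hC _)

lemma pairing_comm (hK : ∀ x, K (-x) = K x) (f g : Ed n → ℝ) :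
    pairing K f g = pairing K g f := by
  unfold pairing
  rw [Measure.volume_eq_prod, ← integral_prod_swap]
  congr 1
  funext z
  simp only [Prod.fst_swap, Prod.snd_swap]
  rw [← hK, neg_sub, mul_comm (f z.2)]

lemma pairing_sum_left {ι : Type*} (s : Finset ι) {F : ι → Ed n → ℝ} (hK : BddSmooth K)
    (hF : ∀ i ∈ s, Integrable (F i)) (hg : Integrable g) :
    pairing K (fun x => ∑ i ∈ s, F i x) g = ∑ i ∈ s, pairing K (F i) g := by
  simp only [pairing, Finset.sum_mul, Finset.mul_sum]
  exact integral_finsetSum s fun i hi => integrable_pairing hK (hF i hi) hg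

lemma pairing_sum_right {ι : Type*} (s : Finset ι) {F : ι → Ed n → ℝ} (hK : BddSmooth K)
    (hf : Integrable f) (hF : ∀ i ∈ s, Integrable (F i)) :
    pairing K f (fun x => ∑ i ∈ s, F i x) = ∑ i ∈ s, pairing K f (F i) := by
  simp only [pairing, Finset.mul_sum]
  exact integral_finsetSum s fun i hi => integrable_pairing hK hf (hF i hi)

lemma pairing_sub_right {g₁ g₂ : Ed n → ℝ} (hK : BddSmooth K) (hf : Integrable f)
    (h₁ : Integrable g₁) (h₂ : Integrable g₂) :
    pairing K f (fun x => g₁ x - g₂ x) = pairing K f g₁ - pairing K f g₂ := by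
  simp only [pairing, mul_sub]
  exact integral_sub (integrable_pairing hK hf h₁) (integrable_pairing hK hf h₂)

lemma pairing_const_mul_left (c : ℝ) (K f g : Ed n → ℝ) :
    pairing K (fun x => c * f x) g = c * pairing K f g := by
  simp only [pairing, ← integral_const_mul]
  congr 1; funext z; ring

lemma pairing_const_mul_right (c : ℝ) (K f g : Ed n → ℝ) :
    pairing K f (fun x => c * g x) = c * pairing K f g := by
  simp only [pairing, ← integral_const_mul]
  congr 1; funext z; ring

lemma pairing_neg_left (K f g : Ed n → ℝ) :
    pairing K (fun x => -f x) g = -pairing K f g := by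
  simpa using pairing_const_mul_left (-1) K f g

lemma fderiv_sub_apply_prod {K : Ed n → ℝ} (hK : Differentiable ℝ K) (z v : Ed n × Ed n) :
    fderiv ℝ (fun z : Ed n × Ed n => K (z.1 - z.2)) z v = fderiv ℝ K (z.1 - z.2) (v.1 - v.2) := by
  have h1 : HasFDerivAt (fun z : Ed n × Ed n => z.1 - z.2)
      (ContinuousLinearMap.fst ℝ (Ed n) (Ed n) - ContinuousLinearMap.snd ℝ (Ed n) (Ed n)) z :=
    hasFDerivAt_fst.sub hasFDerivAt_snd
  have h2 : HasFDerivAt (fun z : Ed n × Ed n => K (z.1 - z.2)) _ z :=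
    (hK (z.1 - z.2)).hasFDerivAt.comp z h1
  rw [h2.fderiv]
  simp

lemma fderiv_mul_apply_prod (hf : Differentiable ℝ f) (hg : Differentiable ℝ g)
    (z v : Ed n × Ed n) :
    fderiv ℝ (fun z : Ed n × Ed n => f z.1 * g z.2) z v
      = fderiv ℝ f z.1 v.1 * g z.2 + f z.1 * fderiv ℝ g z.2 v.2 := by
  have h1 : HasFDerivAt (fun z : Ed n × Ed n => f z.1) _ z :=
    (hf z.1).hasFDerivAt.comp z hasFDerivAt_fst
  have h2 : HasFDerivAt (fun z : Ed n × Ed n => g z.2) _ z :=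
    (hg z.2).hasFDerivAt.comp z hasFDerivAt_snd
  rw [(h1.fun_mul h2).fderiv]
  simp
  ring

lemma pairing_pdR_left (hK : BddSmooth K) (hf : DiffIntegrable f) (hg : DiffIntegrable g)
    (k : Fin n) : pairing K (pdR k f) g = -pairing (pdR k K) f g := by
  have hKd := hK.differentiable
  have hfd := hf.differentiable
  have hgd := hg.differentiable
  have h1 := integral_mul_fderiv_eq_neg_fderiv_mul_of_integrable
    (μ := (volume : Measure (Ed n × Ed n)))
    (f := fun z : Ed n × Ed n => K (z.1 - z.2)) (g := fun z => f z.1 * g z.2)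
    (v := (EuclideanSpace.single k (1 : ℝ), (0 : Ed n))) ?_ ?_ ?_ ?_ ?_
  · simp only [fderiv_sub_apply_prod hKd, fderiv_mul_apply_prod hfd hgd, map_zero, mul_zero,
      add_zero, sub_zero] at h1
    exact h1
  · simp only [fderiv_sub_apply_prod hKd, sub_zero]
    exact integrable_pairing (hK.pdR k) hf.integrable hg.integrable
  · simp only [fderiv_mul_apply_prod hfd hgd, map_zero, mul_zero, add_zero]
    exact integrable_pairing hK (hf.integrable_pdR k) hg.integrable
  · exact integrable_pairing hK hf.integrable hg.integrable
  · intro z _; fun_prop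
  · intro z _; fun_prop

lemma pairing_pdR_right (hK : BddSmooth K) (hf : DiffIntegrable f) (hg : DiffIntegrable g)
    (k : Fin n) : pairing K f (pdR k g) = pairing (pdR k K) f g := by
  have hKd := hK.differentiable
  have hfd := hf.differentiable
  have hgd := hg.differentiable
  have h1 := integral_mul_fderiv_eq_neg_fderiv_mul_of_integrable
    (μ := (volume : Measure (Ed n × Ed n)))
    (f := fun z : Ed n × Ed n => K (z.1 - z.2)) (g := fun z => f z.1 * g z.2)
    (v := ((0 : Ed n), EuclideanSpace.single k (1 : ℝ))) ?_ ?_ ?_ ?_ ?_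
  · simp only [fderiv_sub_apply_prod hKd, fderiv_mul_apply_prod hfd hgd, map_zero, zero_mul,
      zero_add, zero_sub, map_neg, neg_mul, integral_neg, neg_neg] at h1
    exact h1
  · simp only [fderiv_sub_apply_prod hKd, zero_sub, map_neg, neg_mul]
    exact (integrable_pairing (hK.pdR k) hf.integrable hg.integrable).neg
  · simp only [fderiv_mul_apply_prod hfd hgd, map_zero, zero_mul, zero_add]
    exact integrable_pairing hK hf.integrable (hg.integrable_pdR k)
  · exact integrable_pairing hK hf.integrable hg.integrable
  · intro z _; fun_prop
  · intro z _; fun_prop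

end Pairing

/-- Continuous functions of `(t, x)` decaying faster than any power of `x`, locally uniformly
in `t`. -/
structure RapidDecay {n : ℕ} {E : Type*} [NormedAddCommGroup E] (f : ℝ × Ed n → E) : Prop where
  continuous : Continuous f
  decay : ∀ (m : ℕ) (a b : ℝ), ∃ C : ℝ, ∀ t ∈ Set.Icc a b, ∀ x : Ed n,
    (1 + ‖x‖) ^ m * ‖f (t, x)‖ ≤ C

namespace RapidDecay

variable {n : ℕ} {E : Type*} [NormedAddCommGroup E] {f : ℝ × Ed n → E}

lemma exists_integrable_bound (hf : RapidDecay f) (a b : ℝ) :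
    ∃ φ : Ed n → ℝ, Integrable φ ∧ ∀ t ∈ Set.Icc a b, ∀ x, ‖f (t, x)‖ ≤ φ x := by
  obtain ⟨C, hC⟩ := hf.decay (n + 1) a b
  refine ⟨fun x => C * (1 + ‖x‖) ^ (-((n + 1 : ℕ) : ℝ)),
    (integrable_one_add_norm (by simp)).const_mul C, fun t ht x => ?_⟩
  have hx : 0 < 1 + ‖x‖ := by positivity
  beta_reduce
  rw [Real.rpow_neg hx.le, Real.rpow_natCast, ← div_eq_mul_inv, le_div_iff₀ (by positivity),
    mul_comm]
  exact hC t ht x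

lemma exists_bound (hf : RapidDecay f) (t : ℝ) : ∃ C : ℝ, ∀ x, ‖f (t, x)‖ ≤ C := by
  obtain ⟨C, hC⟩ := hf.decay 0 t t
  exact ⟨C, fun x => by simpa using hC t (by simp) x⟩

lemma continuous_slice (hf : RapidDecay f) (t : ℝ) : Continuous fun x => f (t, x) :=
  hf.continuous.comp (by fun_prop)

lemma integrable_slice (hf : RapidDecay f) (t : ℝ) : Integrable fun x => f (t, x) := by
  obtain ⟨φ, hφ, hb⟩ := hf.exists_integrable_bound t t
  exact hφ.mono' (hf.continuous_slice t).aestronglyMeasurable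
    (.of_forall fun x => hb t (by simp) x)

lemma inner {f g : ℝ × Ed n → ℂ} (hf : RapidDecay f) (hg : RapidDecay g) :
    RapidDecay fun p => Inner.inner ℝ (f p) (g p) := by
  refine ⟨hf.continuous.inner hg.continuous, fun m a b => ?_⟩
  obtain ⟨C, hC⟩ := hf.decay m a b
  obtain ⟨D, hD⟩ := hg.decay 0 a b
  refine ⟨C * D, fun t ht x => ?_⟩
  have h1 := hC t ht x
  have h2 := hD t ht x
  rw [pow_zero, one_mul] at h2
  calc (1 + ‖x‖) ^ m * ‖Inner.inner ℝ (f (t, x)) (g (t, x))‖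
      ≤ (1 + ‖x‖) ^ m * (‖f (t, x)‖ * ‖g (t, x)‖) := by
        gcongr
        exact norm_inner_le_norm _ _
    _ = ((1 + ‖x‖) ^ m * ‖f (t, x)‖) * ‖g (t, x)‖ := by ring
    _ ≤ C * D := mul_le_mul h1 h2 (norm_nonneg _) (le_trans (by positivity) h1)

lemma add {f g : ℝ × Ed n → E} (hf : RapidDecay f) (hg : RapidDecay g) :
    RapidDecay fun p => f p + g p := by
  refine ⟨hf.continuous.add hg.continuous, fun m a b => ?_⟩
  obtain ⟨C, hC⟩ := hf.decay m a b
  obtain ⟨D, hD⟩ := hg.decay m a b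
  refine ⟨C + D, fun t ht x => ?_⟩
  calc (1 + ‖x‖) ^ m * ‖f (t, x) + g (t, x)‖
      ≤ (1 + ‖x‖) ^ m * (‖f (t, x)‖ + ‖g (t, x)‖) := by
        gcongr
        exact norm_add_le _ _
    _ = (1 + ‖x‖) ^ m * ‖f (t, x)‖ + (1 + ‖x‖) ^ m * ‖g (t, x)‖ := by ring
    _ ≤ C + D := add_le_add (hC t ht x) (hD t ht x)

end RapidDecay

lemma hasDerivAt_pairing {n : ℕ} {K : Ed n → ℝ} {f f' g g' : ℝ × Ed n → ℝ} (hK : BddSmooth K)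
    (hf : RapidDecay f) (hf' : RapidDecay f') (hg : RapidDecay g) (hg' : RapidDecay g')
    (hfd : ∀ t x, HasDerivAt (fun s => f (s, x)) (f' (t, x)) t)
    (hgd : ∀ t x, HasDerivAt (fun s => g (s, x)) (g' (t, x)) t) (t : ℝ) :
    HasDerivAt (fun s => pairing K (fun x => f (s, x)) (fun y => g (s, y)))
      (pairing K (fun x => f' (t, x)) (fun y => g (t, y))
        + pairing K (fun x => f (t, x)) (fun y => g' (t, y))) t := by
  have hKc : Continuous K := hK.contDiff.continuous
  obtain ⟨C, hC0, hC⟩ := hK.exists_abs_le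
  obtain ⟨φ, hφ, hφb⟩ := hf.exists_integrable_bound (t - 1) (t + 1)
  obtain ⟨φ', hφ', hφb'⟩ := hf'.exists_integrable_bound (t - 1) (t + 1)
  obtain ⟨ψ, hψ, hψb⟩ := hg.exists_integrable_bound (t - 1) (t + 1)
  obtain ⟨ψ', hψ', hψb'⟩ := hg'.exists_integrable_bound (t - 1) (t + 1)
  have h1 := hasDerivAt_integral_of_dominated_loc_of_deriv_le
    (μ := (volume : Measure (Ed n × Ed n))) (x₀ := t)
    (F := fun s z => K (z.1 - z.2) * (f (s, z.1) * g (s, z.2)))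
    (F' := fun s z => K (z.1 - z.2) * (f' (s, z.1) * g (s, z.2) + f (s, z.1) * g' (s, z.2)))
    (bound := fun z => C * (φ' z.1 * ψ z.2 + φ z.1 * ψ' z.2))
    (s := Set.Icc (t - 1) (t + 1))
    (Icc_mem_nhds (by linarith) (by linarith))
    (.of_forall fun s => (integrable_pairing hK (hf.integrable_slice s)
      (hg.integrable_slice s)).aestronglyMeasurable)
    (integrable_pairing hK (hf.integrable_slice t) (hg.integrable_slice t)) ?_
    (.of_forall fun z s hs => ?_) (((hφ'.mul_prod hψ).add (hφ.mul_prod hψ')).const_mul C)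
    (.of_forall fun z s _ => ((hfd s z.1).mul (hgd s z.2)).const_mul _)
  · refine h1.2.congr_deriv ?_
    simp only [pairing, mul_add]
    exact (integral_add (integrable_pairing hK (hf'.integrable_slice t) (hg.integrable_slice t))
      (integrable_pairing hK (hf.integrable_slice t) (hg'.integrable_slice t)))
  · have h1 := hf.continuous_slice t
    have h2 := hf'.continuous_slice t
    have h3 := hg.continuous_slice t
    have h4 := hg'.continuous_slice t
    exact Continuous.aestronglyMeasurable
      ((hKc.comp (by fun_prop)).mul
        (((h2.comp continuous_fst).mul (h3.comp continuous_snd)).add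
          ((h1.comp continuous_fst).mul (h4.comp continuous_snd))))
  · rw [norm_mul]
    refine mul_le_mul (hC _) ((norm_add_le _ _).trans (add_le_add ?_ ?_)) (norm_nonneg _) hC0
    · rw [norm_mul]
      exact mul_le_mul (hφb' s hs _) (hψb s hs _) (norm_nonneg _)
        ((norm_nonneg _).trans (hφb' s hs _))
    · rw [norm_mul]
      exact mul_le_mul (hφb s hs _) (hψb' s hs _) (norm_nonneg _)
        ((norm_nonneg _).trans (hφb s hs _))

/-- Smooth functions of `(t, x)` which are Schwartz in `x` with all their derivatives, locally
uniformly in `t`. -/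
structure SmoothDecay {n : ℕ} (F : ℝ × Ed n → ℂ) : Prop where
  contDiff : ContDiff ℝ (⊤ : ℕ∞) F
  decay : ∀ (N m : ℕ) (a b : ℝ), ∃ C : ℝ, ∀ t ∈ Set.Icc a b, ∀ x : Ed n,
    (1 + ‖x‖) ^ m * ‖iteratedFDeriv ℝ N F (t, x)‖ ≤ C

/-- The `k`-th spatial coordinate direction in space-time. -/
abbrev spaceDir {n : ℕ} (k : Fin n) : ℝ × Ed n := (0, EuclideanSpace.single k 1)

/-- The time direction in space-time. -/
abbrev timeDir (n : ℕ) : ℝ × Ed n := (1, 0)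

section Slices

variable {n : ℕ} {E : Type*} [NormedAddCommGroup E] [NormedSpace ℝ E] {f : ℝ × Ed n → E}

lemma fderiv_space_slice (hf : Differentiable ℝ f) (t : ℝ) (x : Ed n) (k : Fin n) :
    fderiv ℝ (fun y => f (t, y)) x (EuclideanSpace.single k 1)
      = dirDeriv (spaceDir k) f (t, x) := by
  have h1 : HasFDerivAt (fun y => f (t, y)) _ x :=
    (hf (t, x)).hasFDerivAt.comp x ((hasFDerivAt_const t x).prodMk (hasFDerivAt_id x))
  rw [h1.fderiv]
  simp [dirDeriv]

lemma hasDerivAt_time_slice (hf : Differentiable ℝ f) (t : ℝ) (x : Ed n) :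
    HasDerivAt (fun s => f (s, x)) (dirDeriv (timeDir n) f (t, x)) t :=
  (hf (t, x)).hasFDerivAt.comp_hasDerivAt t ((hasDerivAt_id t).prodMk (hasDerivAt_const t x))

end Slices

lemma dirDeriv_inner {E : Type*} [NormedAddCommGroup E] [NormedSpace ℝ E] {F G : E → ℂ}
    (hF : Differentiable ℝ F) (hG : Differentiable ℝ G) (v : E) (p : E) :
    dirDeriv v (fun q => Inner.inner ℝ (F q) (G q)) p
      = Inner.inner ℝ (dirDeriv v F p) (G p) + Inner.inner ℝ (F p) (dirDeriv v G p) := by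
  simp only [dirDeriv]
  rw [fderiv_inner_apply ℝ (hF p) (hG p), add_comm]

lemma dirDeriv_const_mul {E : Type*} [NormedAddCommGroup E] [NormedSpace ℝ E] {F : E → ℂ}
    (hF : Differentiable ℝ F) (c : ℂ) (v : E) :
    dirDeriv v (fun q => c * F q) = fun p => c * dirDeriv v F p := by
  funext p
  simp only [dirDeriv]
  rw [fderiv_const_mul (hF p)]
  simp

namespace SmoothDecay

variable {n : ℕ} {F G : ℝ × Ed n → ℂ}

protected lemma differentiable (hF : SmoothDecay F) : Differentiable ℝ F :=
  hF.contDiff.differentiable (by simp)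

protected lemma dirDeriv (hF : SmoothDecay F) (v : ℝ × Ed n) : SmoothDecay (dirDeriv v F) := by
  refine ⟨hF.contDiff.dirDeriv_top v, fun N m a b => ?_⟩
  obtain ⟨C, hC⟩ := hF.decay (N + 1) m a b
  refine ⟨‖v‖ * C, fun t ht x => ?_⟩
  calc (1 + ‖x‖) ^ m * ‖iteratedFDeriv ℝ N (dirDeriv v F) (t, x)‖
      ≤ (1 + ‖x‖) ^ m * (‖v‖ * ‖iteratedFDeriv ℝ (N + 1) F (t, x)‖) := by
        gcongr
        exact hF.contDiff.norm_iteratedFDeriv_dirDeriv_le v N _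
    _ = ‖v‖ * ((1 + ‖x‖) ^ m * ‖iteratedFDeriv ℝ (N + 1) F (t, x)‖) := by ring
    _ ≤ ‖v‖ * C := by gcongr; exact hC t ht x

lemma const_mul (hF : SmoothDecay F) (c : ℂ) : SmoothDecay fun p => c * F p := by
  refine ⟨contDiff_const.mul hF.contDiff, fun N m a b => ?_⟩
  obtain ⟨C, hC⟩ := hF.decay N m a b
  refine ⟨‖c‖ * C, fun t ht x => ?_⟩
  have h1 : iteratedFDeriv ℝ N (fun p => c * F p) (t, x) = c • iteratedFDeriv ℝ N F (t, x) :=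
    iteratedFDeriv_const_smul_apply (a := c)
      (hF.contDiff.contDiffAt.of_le (by exact_mod_cast le_top))
  rw [h1, norm_smul]
  calc (1 + ‖x‖) ^ m * (‖c‖ * ‖iteratedFDeriv ℝ N F (t, x)‖)
      = ‖c‖ * ((1 + ‖x‖) ^ m * ‖iteratedFDeriv ℝ N F (t, x)‖) := by ring
    _ ≤ ‖c‖ * C := by gcongr; exact hC t ht x

lemma rapidDecay (hF : SmoothDecay F) : RapidDecay F :=
  ⟨hF.contDiff.continuous, fun m a b => by simpa using hF.decay 0 m a b⟩

lemma rapidDecay_inner (hF : SmoothDecay F) (hG : SmoothDecay G) :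
    RapidDecay fun p => Inner.inner ℝ (F p) (G p) :=
  hF.rapidDecay.inner hG.rapidDecay

lemma differentiable_inner (hF : SmoothDecay F) (hG : SmoothDecay G) :
    Differentiable ℝ fun p => Inner.inner ℝ (F p) (G p) :=
  hF.differentiable.inner ℝ hG.differentiable

lemma pdR_inner (hF : SmoothDecay F) (hG : SmoothDecay G) (k : Fin n) (t : ℝ) (x : Ed n) :
    pdR k (fun y => Inner.inner ℝ (F (t, y)) (G (t, y))) x
      = Inner.inner ℝ (dirDeriv (spaceDir k) F (t, x)) (G (t, x))
        + Inner.inner ℝ (F (t, x)) (dirDeriv (spaceDir k) G (t, x)) := by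
  rw [← dirDeriv_inner hF.differentiable hG.differentiable]
  exact fderiv_space_slice (hF.differentiable_inner hG) t x k

lemma diffIntegrable_inner (hF : SmoothDecay F) (hG : SmoothDecay G) (t : ℝ) :
    DiffIntegrable fun x => Inner.inner ℝ (F (t, x)) (G (t, x)) where
  differentiable := (hF.differentiable_inner hG).comp (by fun_prop)
  integrable := (hF.rapidDecay_inner hG).integrable_slice t
  integrable_pdR k := by
    have h1 : pdR k (fun x => Inner.inner ℝ (F (t, x)) (G (t, x))) = _ :=
      funext fun x => hF.pdR_inner hG k t x
    rw [h1]
    exact (((hF.dirDeriv _).rapidDecay_inner hG).integrable_slice t).add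
      ((hF.rapidDecay_inner (hG.dirDeriv _)).integrable_slice t)

lemma hasDerivAt_inner (hF : SmoothDecay F) (hG : SmoothDecay G) (t : ℝ) (x : Ed n) :
    HasDerivAt (fun s => (Inner.inner ℝ (F (s, x)) (G (s, x)) : ℝ))
      (Inner.inner ℝ (dirDeriv (timeDir n) F (t, x)) (G (t, x))
        + Inner.inner ℝ (F (t, x)) (dirDeriv (timeDir n) G (t, x))) t := by
  rw [← dirDeriv_inner hF.differentiable hG.differentiable]
  exact hasDerivAt_time_slice (hF.differentiable_inner hG) t x

end SmoothDecay

lemma DiffIntegrable.comp_of_hasDerivAt {n : ℕ} {ρ : Ed n → ℝ} (hρ : DiffIntegrable ρ)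
    {C : ℝ} (hC : ∀ x, |ρ x| ≤ C) {φ φ' : ℝ → ℝ} (hφ : ∀ r, HasDerivAt φ (φ' r) r)
    (hφ' : Continuous φ') (h0 : φ 0 = 0) : DiffIntegrable fun x => φ (ρ x) := by
  obtain ⟨D, hD⟩ := isCompact_Icc.exists_bound_of_continuousOn (s := Set.Icc (-C) C)
    hφ'.continuousOn
  have hρc : Continuous ρ := hρ.differentiable.continuous
  have hφd : Differentiable ℝ φ := fun r => (hφ r).differentiableAt
  have hmem (x : Ed n) : ρ x ∈ Set.Icc (-C) C := abs_le.mp (hC x)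
  have hC0 : 0 ≤ C := (abs_nonneg _).trans (hC 0)
  refine ⟨hφd.comp hρ.differentiable, ?_, fun k => ?_⟩
  · refine (hρ.integrable.norm.const_mul D).mono'
      (hφd.continuous.comp hρc).aestronglyMeasurable (.of_forall fun x => ?_)
    have h1 := (convex_Icc (-C) C).norm_image_sub_le_of_norm_hasDerivWithin_le
      (fun r _ => (hφ r).hasDerivWithinAt) hD
      (Set.mem_Icc.mpr ⟨neg_nonpos.mpr hC0, hC0⟩ : (0 : ℝ) ∈ Set.Icc (-C) C) (hmem x)
    simpa [h0] using h1
  · have h1 : pdR k (fun x => φ (ρ x)) = fun x => φ' (ρ x) * pdR k ρ x := by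
      funext x
      have h2 : HasFDerivAt (fun x => φ (ρ x)) _ x :=
        (hφ (ρ x)).comp_hasFDerivAt x (hρ.differentiable x).hasFDerivAt
      simp [pdR, h2.fderiv]
    rw [h1]
    exact (hρ.integrable_pdR k).bdd_mul (hφ'.comp hρc).aestronglyMeasurable
      (.of_forall fun x => hD _ (hmem x))

/-- `Re (ū ∂_k u)`, the companion of the current; it equals `∂_k ρ / 2`. -/
def reCurr {n : ℕ} (u : ℝ → Ed n → ℂ) (k : Fin n) (t : ℝ) (x : Ed n) : ℝ :=
  inner ℝ (u t x) (pd k (u t) x)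

/-- The stress tensor `Re (∂_k ū ∂_l u)`. -/
def stress {n : ℕ} (u : ℝ → Ed n → ℂ) (k l : Fin n) (t : ℝ) (x : Ed n) : ℝ :=
  inner ℝ (pd k (u t) x) (pd l (u t) x)

/-- The tensor `Re (ū ∂_k ∂_l u)`. -/
def reHess {n : ℕ} (u : ℝ → Ed n → ℂ) (k l : Fin n) (t : ℝ) (x : Ed n) : ℝ :=
  inner ℝ (u t x) (pd k (fun y => pd l (u t) y) x)

section Densities

variable {n : ℕ} {u : ℝ → Ed n → ℂ}

lemma pd_slice (hu : SmoothDecay fun p : ℝ × Ed n => u p.1 p.2) (k : Fin n) (t : ℝ) (x : Ed n) :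
    pd k (u t) x = dirDeriv (spaceDir k) (fun p : ℝ × Ed n => u p.1 p.2) (t, x) :=
  fderiv_space_slice hu.differentiable t x k

lemma pd_pd_slice (hu : SmoothDecay fun p : ℝ × Ed n => u p.1 p.2) (k l : Fin n) (t : ℝ)
    (x : Ed n) :
    pd k (fun y => pd l (u t) y) x = dirDeriv (spaceDir k) (dirDeriv (spaceDir l)
      (fun p : ℝ × Ed n => u p.1 p.2)) (t, x) := by
  simp only [pd_slice hu]
  exact fderiv_space_slice (hu.dirDeriv _).differentiable t x k

lemma dens_eq_inner (u : ℝ → Ed n → ℂ) (t : ℝ) (x : Ed n) :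
    dens u t x = inner ℝ (u t x) (u t x) :=
  (real_inner_self_eq_norm_sq _).symm

lemma curr_eq_inner (u : ℝ → Ed n → ℂ) (k : Fin n) (t : ℝ) (x : Ed n) :
    curr u k t x = inner ℝ (I * u t x) (pd k (u t) x) := by
  simp [curr, Complex.inner]
  ring

variable (hu : SmoothDecay fun p : ℝ × Ed n => u p.1 p.2)
include hu

lemma diffIntegrable_dens (t : ℝ) : DiffIntegrable (dens u t) := by
  simpa only [← dens_eq_inner] using hu.diffIntegrable_inner hu t

lemma diffIntegrable_curr (k : Fin n) (t : ℝ) : DiffIntegrable (curr u k t) := by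
  simpa only [← pd_slice hu, ← curr_eq_inner] using
    (hu.const_mul I).diffIntegrable_inner (hu.dirDeriv (spaceDir k)) t

lemma diffIntegrable_reCurr (k : Fin n) (t : ℝ) : DiffIntegrable (reCurr u k t) := by
  have h1 := hu.diffIntegrable_inner (hu.dirDeriv (spaceDir k)) t
  simp only [← pd_slice hu] at h1
  exact h1

lemma diffIntegrable_stress (k l : Fin n) (t : ℝ) : DiffIntegrable (stress u k l t) := by
  have h1 := (hu.dirDeriv (spaceDir k)).diffIntegrable_inner (hu.dirDeriv (spaceDir l)) t
  simp only [← pd_slice hu] at h1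
  exact h1

lemma diffIntegrable_reHess (k l : Fin n) (t : ℝ) : DiffIntegrable (reHess u k l t) := by
  have h1 := hu.diffIntegrable_inner ((hu.dirDeriv (spaceDir l)).dirDeriv (spaceDir k)) t
  simp only [← pd_pd_slice hu] at h1
  exact h1

lemma pdR_dens (k : Fin n) (t : ℝ) : pdR k (dens u t) = fun x => 2 * reCurr u k t x := by
  funext x
  have h1 := hu.pdR_inner hu k t x
  simp only [← dens_eq_inner, ← pd_slice hu] at h1
  refine h1.trans ?_
  rw [real_inner_comm, reCurr]
  ring

lemma reHess_eq (k l : Fin n) (t : ℝ) :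
    reHess u k l t = fun x => pdR k (reCurr u l t) x - stress u k l t x := by
  funext x
  have h1 := hu.pdR_inner (hu.dirDeriv (spaceDir l)) k t x
  simp only [← pd_slice hu, ← pd_pd_slice hu] at h1
  rw [eq_sub_iff_add_eq, add_comm]
  exact h1.symm

end Densities

/-- The pressure `ρ g(ρ) - G(ρ)`. -/
def pressure {n : ℕ} (g G : ℝ → ℝ) (u : ℝ → Ed n → ℂ) (t : ℝ) (x : Ed n) : ℝ :=
  dens u t x * g (dens u t x) - G (dens u t x)

section Pressure

variable {n : ℕ} {u : ℝ → Ed n → ℂ} {g G : ℝ → ℝ}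

lemma hasDerivAt_mul_sub_primitive (hg : ContDiff ℝ (⊤ : ℕ∞) g)
    (hG : ∀ r : ℝ, G r = ∫ s in (0 : ℝ)..r, g s) (r : ℝ) :
    HasDerivAt (fun r => r * g r - G r) (r * deriv g r) r := by
  have h1 : HasDerivAt G (g r) r := by
    rw [show G = fun r => ∫ s in (0 : ℝ)..r, g s from funext hG]
    exact hg.continuous.integral_hasStrictDerivAt 0 r |>.hasDerivAt
  have h2 : HasDerivAt g (deriv g r) r := (hg.differentiable (by simp) r).hasDerivAt
  exact (((hasDerivAt_id r).mul h2).sub h1).congr_deriv (by simp)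

lemma diffIntegrable_pressure (hu : SmoothDecay fun p : ℝ × Ed n => u p.1 p.2)
    (hg : ContDiff ℝ (⊤ : ℕ∞) g) (hG : ∀ r : ℝ, G r = ∫ s in (0 : ℝ)..r, g s) (t : ℝ) :
    DiffIntegrable (pressure g G u t) := by
  obtain ⟨C, hC⟩ := (hu.rapidDecay_inner hu).exists_bound t
  simp only [← dens_eq_inner, Real.norm_eq_abs] at hC
  exact (diffIntegrable_dens hu t).comp_of_hasDerivAt hC (hasDerivAt_mul_sub_primitive hg hG)
    (continuous_id.mul (hg.continuous_deriv (by simp))) (by simp [hG])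

lemma pdR_pressure (hu : SmoothDecay fun p : ℝ × Ed n => u p.1 p.2)
    (hg : ContDiff ℝ (⊤ : ℕ∞) g) (hG : ∀ r : ℝ, G r = ∫ s in (0 : ℝ)..r, g s) (k : Fin n)
    (t : ℝ) (x : Ed n) :
    pdR k (pressure g G u t) x
      = dens u t x * (deriv g (dens u t x) * pdR k (dens u t) x) := by
  have h1 : HasFDerivAt (pressure g G u t) _ x :=
    (hasDerivAt_mul_sub_primitive hg hG (dens u t x)).comp_hasFDerivAt x
      ((diffIntegrable_dens hu t).differentiable x).hasFDerivAt
  simp [pdR, h1.fderiv, mul_assoc]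

end Pressure

section Evolution

variable {n : ℕ} {u : ℝ → Ed n → ℂ} {g G : ℝ → ℝ}

lemma IsNLSSolution.smoothDecay (hu : IsNLSSolution g u) :
    SmoothDecay fun p : ℝ × Ed n => u p.1 p.2 :=
  ⟨hu.1, hu.2.1⟩

lemma IsNLSSolution.dirDeriv_time (hu : IsNLSSolution g u) (t : ℝ) (x : Ed n) :
    dirDeriv (timeDir n) (fun p : ℝ × Ed n => u p.1 p.2) (t, x)
      = I / 2 * lapC (u t) x - I * ((g (dens u t x) : ℝ) : ℂ) * u t x := by
  have h1 := hu.2.2 t x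
  rw [(hasDerivAt_time_slice hu.smoothDecay.differentiable t x).deriv] at h1
  have h2 := congrArg (fun z => -I * z) h1
  simp only [← mul_assoc, neg_mul, I_mul_I, neg_neg, one_mul] at h2
  rw [h2, dens]
  ring

lemma IsNLSSolution.pd_dirDeriv_time (hg : ContDiff ℝ (⊤ : ℕ∞) g) (hu : IsNLSSolution g u)
    (k : Fin n) (t : ℝ) (x : Ed n) :
    pd k (fun y => dirDeriv (timeDir n) (fun p : ℝ × Ed n => u p.1 p.2) (t, y)) x
      = I / 2 * (∑ l, pd k (fun y => pd l (fun z => pd l (u t) z) y) x)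
        - I * (((deriv g (dens u t x) * pdR k (dens u t) x : ℝ) : ℂ) * u t x
          + ((g (dens u t x) : ℝ) : ℂ) * pd k (u t) x) := by
  have hS := hu.smoothDecay
  have hd (l : Fin n) : DifferentiableAt ℝ (fun y => pd l (fun z => pd l (u t) z) y) x := by
    simp only [pd_pd_slice hS]
    exact (((hS.dirDeriv _).dirDeriv _).differentiable.comp (by fun_prop)) x
  have hL : HasFDerivAt (lapC (u t))
      (∑ l, fderiv ℝ (fun y => pd l (fun z => pd l (u t) z) y) x) x :=
    HasFDerivAt.fun_sum fun l _ => (hd l).hasFDerivAt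
  have hU : HasFDerivAt (u t) (fderiv ℝ (u t) x) x :=
    (hS.differentiable.comp (by fun_prop : Differentiable ℝ fun y : Ed n => (t, y))
      x).hasFDerivAt
  have hγ : HasFDerivAt (fun y => g (dens u t y)) _ x :=
    ((hg.differentiable (by simp) (dens u t x)).hasDerivAt).comp_hasFDerivAt x
      ((diffIntegrable_dens hS t).differentiable x).hasFDerivAt
  have hγc : HasFDerivAt (fun y => ((g (dens u t y) : ℝ) : ℂ)) _ x :=
    Complex.ofRealCLM.hasFDerivAt.comp x hγ
  have h1 := (hL.const_mul (I / 2)).sub ((hγc.const_mul I).mul hU)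
  simp only [hu.dirDeriv_time]
  refine (congrArg (fun A : Ed n →L[ℝ] ℂ => A (EuclideanSpace.single k 1)) h1.fderiv).trans ?_
  simp [pd, pdR]
  ring

end Evolution

lemma Complex.real_inner_eq_re_mul_add_im_mul (w z : ℂ) :
    inner ℝ w z = w.re * z.re + w.im * z.im := by
  simp [Complex.inner]
  ring

section ConservationLaws

variable {n : ℕ} {u v : ℝ → Ed n → ℂ} {g G : ℝ → ℝ}

lemma pdR_curr_self (hu : SmoothDecay fun p : ℝ × Ed n => u p.1 p.2) (l : Fin n) (t : ℝ)
    (x : Ed n) :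
    pdR l (curr u l t) x = inner ℝ (I * u t x) (pd l (fun y => pd l (u t) y) x) := by
  have h1 := (hu.const_mul I).pdR_inner (hu.dirDeriv (spaceDir l)) l t x
  simp only [dirDeriv_const_mul hu.differentiable, ← pd_pd_slice hu, ← pd_slice hu,
    ← curr_eq_inner] at h1
  refine h1.trans ?_
  simp only [Complex.real_inner_eq_re_mul_add_im_mul]
  simp
  ring

/-- Conservation of mass: `∂_t ρ = -div j`. -/
lemma IsNLSSolution.inner_dirDeriv_time (hu : IsNLSSolution g u) (t : ℝ) (x : Ed n) :
    (inner ℝ (dirDeriv (timeDir n) (fun p : ℝ × Ed n => u p.1 p.2) (t, x)) (u t x)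
      + inner ℝ (u t x) (dirDeriv (timeDir n) (fun p : ℝ × Ed n => u p.1 p.2) (t, x)) : ℝ)
      = -∑ l, pdR l (curr u l t) x := by
  simp only [pdR_curr_self hu.smoothDecay, ← inner_sum]
  rw [hu.dirDeriv_time, lapC]
  generalize (∑ k, pd k (fun y => pd k (u t) y) x) = L
  simp only [Complex.real_inner_eq_re_mul_add_im_mul]
  simp
  ring

/-- Conservation of momentum: the time derivative of the current is the divergence of the
stress tensor minus the gradient of the pressure. -/
lemma IsNLSSolution.inner_dirDeriv_time_curr (hg : ContDiff ℝ (⊤ : ℕ∞) g)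
    (hG : ∀ r : ℝ, G r = ∫ s in (0 : ℝ)..r, g s) (hu : IsNLSSolution g u) (k : Fin n) (t : ℝ)
    (x : Ed n) :
    (inner ℝ (I * dirDeriv (timeDir n) (fun p : ℝ × Ed n => u p.1 p.2) (t, x)) (pd k (u t) x)
      + inner ℝ (I * u t x) (dirDeriv (timeDir n) (dirDeriv (spaceDir k)
        (fun p : ℝ × Ed n => u p.1 p.2)) (t, x)) : ℝ)
      = (1 / 2) * ∑ l, (pdR l (reHess u k l t) x - pdR l (stress u l k t) x)
        - pdR k (pressure g G u t) x := by
  have hS := hu.smoothDecay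
  have h1 (l : Fin n) : pdR l (reHess u k l t) x - pdR l (stress u l k t) x
      = inner ℝ (u t x) (pd k (fun y => pd l (fun z => pd l (u t) z) y) x)
        - inner ℝ (pd l (fun z => pd l (u t) z) x) (pd k (u t) x) := by
    have h2 := hS.pdR_inner ((hS.dirDeriv (spaceDir l)).dirDeriv (spaceDir k)) l t x
    have h3 := (hS.dirDeriv (spaceDir l)).pdR_inner (hS.dirDeriv (spaceDir k)) l t x
    have h4 : pd k (fun y => pd l (fun z => pd l (u t) z) y) x
        = dirDeriv (spaceDir k) (dirDeriv (spaceDir l) (dirDeriv (spaceDir l)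
          (fun p : ℝ × Ed n => u p.1 p.2))) (t, x) := by
      simp only [pd_pd_slice hS]
      exact fderiv_space_slice ((hS.dirDeriv _).dirDeriv _).differentiable t x k
    rw [(hS.dirDeriv (spaceDir l)).contDiff.dirDeriv_comm (spaceDir l) (spaceDir k), ← h4] at h2
    rw [hS.contDiff.dirDeriv_comm (spaceDir l) (spaceDir k)] at h3
    simp only [← pd_pd_slice hS, ← pd_slice hS] at h2 h3
    have h5 : pdR l (reHess u k l t) x = _ := h2
    have h6 : pdR l (stress u l k t) x = _ := h3
    rw [h5, h6]
    ring
  have h7 : dirDeriv (timeDir n) (dirDeriv (spaceDir k) (fun p : ℝ × Ed n => u p.1 p.2)) (t, x)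
      = pd k (fun y => dirDeriv (timeDir n) (fun p : ℝ × Ed n => u p.1 p.2) (t, y)) x := by
    rw [hS.contDiff.dirDeriv_comm]
    exact (fderiv_space_slice (hS.dirDeriv _).differentiable t x k).symm
  simp only [h1, Finset.sum_sub_distrib, ← inner_sum, ← sum_inner]
  rw [h7, hu.pd_dirDeriv_time hg, hu.dirDeriv_time, pdR_pressure hS hg hG, lapC,
    dens_eq_inner u t x]
  generalize (∑ l, pd l (fun y => pd l (u t) y) x) = L
  generalize (∑ l, pd k (fun y => pd l (fun z => pd l (u t) z) y) x) = M
  generalize pdR k (dens u t) x = d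
  simp only [Complex.real_inner_eq_re_mul_add_im_mul]
  simp
  ring

lemma IsNLSSolution.hasDerivAt_pairing_dens_curr (hg : ContDiff ℝ (⊤ : ℕ∞) g)
    (hG : ∀ r : ℝ, G r = ∫ s in (0 : ℝ)..r, g s) (hu : IsNLSSolution g u)
    (hv : IsNLSSolution g v) {K : Ed n → ℝ} (hK : BddSmooth K) (k : Fin n) (t : ℝ) :
    HasDerivAt (fun s => pairing K (dens u s) (curr v k s))
      (pairing K (fun x => -∑ l, pdR l (curr u l t) x) (curr v k t)
        + pairing K (dens u t)
          (fun y => (1 / 2) * ∑ l, (pdR l (reHess v k l t) y - pdR l (stress v l k t) y)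
            - pdR k (pressure g G v t) y)) t := by
  have hS := hu.smoothDecay
  have hT := hv.smoothDecay
  have hTk := hT.dirDeriv (spaceDir k)
  have hTI := hT.const_mul I
  have h1 := hasDerivAt_pairing hK (hS.rapidDecay_inner hS)
    (((hS.dirDeriv (timeDir n)).rapidDecay_inner hS).add
      (hS.rapidDecay_inner (hS.dirDeriv (timeDir n))))
    (hTI.rapidDecay_inner hTk)
    (((hTI.dirDeriv (timeDir n)).rapidDecay_inner hTk).add
      (hTI.rapidDecay_inner (hTk.dirDeriv (timeDir n))))
    (hS.hasDerivAt_inner hS) (hTI.hasDerivAt_inner hTk) t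
  simp only [dirDeriv_const_mul hT.differentiable, ← pd_slice hT, hu.inner_dirDeriv_time,
    hv.inner_dirDeriv_time_curr hg hG, ← dens_eq_inner, ← curr_eq_inner] at h1
  exact h1

end ConservationLaws

section Morawetz

variable {n : ℕ} {u v : ℝ → Ed n → ℂ} {g G : ℝ → ℝ} {h : Ed n → ℝ}

lemma bddSmooth_hess (hK : ∀ k, BddSmooth (pdR k h)) (k l : Fin n) : BddSmooth (hess h k l) :=
  (hK l).pdR k

lemma pairing_hess_pdR (hK : ∀ k, BddSmooth (pdR k h))
    {f₁ f₂ : Ed n → ℝ} (h₁ : DiffIntegrable f₁) (h₂ : DiffIntegrable f₂) (k l : Fin n) :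
    pairing (hess h l k) f₁ (pdR k f₂) = -pairing (hess h k k) (pdR l f₁) f₂ := by
  have h3 : pdR k (hess h l k) = pdR l (hess h k k) :=
    pdR_comm (hK k).contDiff k l
  rw [pairing_pdR_right (bddSmooth_hess hK l k) h₁ h₂,
    pairing_pdR_left (bddSmooth_hess hK k k) h₁ h₂, neg_neg]
  exact congrArg (fun K => pairing K f₁ f₂) h3

lemma pairing_hess_reCurr (hK : ∀ k, BddSmooth (pdR k h))
    (hu : SmoothDecay fun p : ℝ × Ed n => u p.1 p.2)
    (hv : SmoothDecay fun p : ℝ × Ed n => v p.1 p.2) (k l : Fin n) (t : ℝ) :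
    pairing (hess h k l) (reCurr u l t) (reCurr v k t)
      = pairing (hess h l l) (reCurr u k t) (reCurr v k t) := by
  have hd := diffIntegrable_dens hu t
  have ha := diffIntegrable_reCurr hv k t
  have h1 := pairing_pdR_left ((hK l).pdR k) hd ha l
  have h2 := pairing_pdR_left ((hK l).pdR l) hd ha k
  have h3 : pdR l (pdR k (pdR l h)) = pdR k (pdR l (pdR l h)) := pdR_comm (hK l).contDiff l k
  rw [h3, ← h2, pdR_dens hu, pdR_dens hu, pairing_const_mul_left, pairing_const_mul_left] at h1
  exact mul_left_cancel₀ two_ne_zero h1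

lemma IsNLSSolution.hasDerivAt_sum_pairing (hs : ContDiff ℝ (⊤ : ℕ∞) h)
    (hK : ∀ k, BddSmooth (pdR k h)) (hg : ContDiff ℝ (⊤ : ℕ∞) g)
    (hG : ∀ r : ℝ, G r = ∫ s in (0 : ℝ)..r, g s) (hu : IsNLSSolution g u)
    (hv : IsNLSSolution g v) (t : ℝ) :
    HasDerivAt (fun s => ∑ k, pairing (pdR k h) (dens u s) (curr v k s))
      (∑ k, ((∑ l, (pairing (hess h k l) (curr u l t) (curr v k t)
          - pairing (hess h k k) (reCurr u l t) (reCurr v l t)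
          - pairing (hess h k l) (dens u t) (stress v k l t)))
        - pairing (hess h k k) (dens u t) (pressure g G v t))) t := by
  have hS := hu.smoothDecay
  have hT := hv.smoothDecay
  have hP := diffIntegrable_pressure hT hg hG t
  have hd := diffIntegrable_dens hS t
  have hsym (k l : Fin n) : pdR l (pdR k h) = hess h k l := pdR_comm hs l k
  refine HasDerivAt.fun_sum fun k _ =>
    (hu.hasDerivAt_pairing_dens_curr hg hG hv (hK k) k t).congr_deriv ?_
  have hc := diffIntegrable_curr hT k t
  have hi (l : Fin n) : Integrable fun y =>
      pdR l (reHess v k l t) y - pdR l (stress v l k t) y :=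
    ((diffIntegrable_reHess hT k l t).integrable_pdR l).sub
      ((diffIntegrable_stress hT l k t).integrable_pdR l)
  have hA (l : Fin n) : pairing (hess h k l) (dens u t) (reHess v k l t)
      = -(2 * pairing (hess h k k) (reCurr u l t) (reCurr v l t))
        - pairing (hess h k l) (dens u t) (stress v k l t) := by
    have ha := diffIntegrable_reCurr hT l t
    rw [reHess_eq hT, pairing_sub_right (bddSmooth_hess hK k l) hd.integrable (ha.integrable_pdR k)
      (diffIntegrable_stress hT k l t).integrable]
    have h1 := pairing_hess_pdR hK hd ha k l
    rw [show hess h l k = hess h k l from hsym k l, pdR_dens hS, pairing_const_mul_left] at h1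
    rw [h1]
  have hq (l : Fin n) : stress v l k t = stress v k l t :=
    funext fun y => real_inner_comm _ _
  rw [pairing_neg_left, pairing_sum_left _ (hK k)
      (fun l _ => (diffIntegrable_curr hS l t).integrable_pdR l) hc.integrable,
    pairing_sub_right (hK k) hd.integrable
      ((integrable_finsetSum _ fun l _ => hi l).const_mul _) (hP.integrable_pdR k),
    pairing_const_mul_right, pairing_sum_right _ (hK k) hd.integrable (fun l _ => hi l),
    pairing_pdR_right (hK k) hd hP]
  have h2 (l : Fin n) : pairing (pdR k h) (pdR l (curr u l t)) (curr v k t)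
      = -pairing (hess h k l) (curr u l t) (curr v k t) := by
    rw [← hsym, pairing_pdR_left (hK k) (diffIntegrable_curr hS l t) hc]
  have h3 (l : Fin n) : pairing (pdR k h) (dens u t)
      (fun y => pdR l (reHess v k l t) y - pdR l (stress v l k t) y)
      = -(2 * pairing (hess h k k) (reCurr u l t) (reCurr v l t))
        - 2 * pairing (hess h k l) (dens u t) (stress v k l t) := by
    rw [pairing_sub_right (hK k) hd.integrable
        ((diffIntegrable_reHess hT k l t).integrable_pdR l)
        ((diffIntegrable_stress hT l k t).integrable_pdR l),
      pairing_pdR_right (hK k) hd (diffIntegrable_reHess hT k l t),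
      pairing_pdR_right (hK k) hd (diffIntegrable_stress hT l k t), hsym, hA, hq]
    ring
  have h4 : pdR k (pdR k h) = hess h k k := rfl
  simp only [h2, h3, h4, Finset.sum_sub_distrib, Finset.sum_neg_distrib, ← Finset.mul_sum]
  ring


/-- `Φ` is integrable on `ℝⁿ × ℝⁿ` with integral `c`. -/
def HasDoubleIntegral (Φ : Ed n → Ed n → ℝ) (c : ℝ) : Prop :=
  Integrable (fun z : Ed n × Ed n => Φ z.1 z.2) ∧ ∫ z : Ed n × Ed n, Φ z.1 z.2 = c

namespace HasDoubleIntegral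

variable {Φ Ψ : Ed n → Ed n → ℝ} {c d : ℝ}

lemma iterated_eq (hΦ : HasDoubleIntegral Φ c) : ∫ x, ∫ y, Φ x y = c :=
  (integral_prod _ hΦ.1).symm.trans hΦ.2

lemma add (hΦ : HasDoubleIntegral Φ c) (hΨ : HasDoubleIntegral Ψ d) :
    HasDoubleIntegral (fun x y => Φ x y + Ψ x y) (c + d) :=
  ⟨hΦ.1.add hΨ.1, (integral_add hΦ.1 hΨ.1).trans (by rw [hΦ.2, hΨ.2])⟩

lemma sub (hΦ : HasDoubleIntegral Φ c) (hΨ : HasDoubleIntegral Ψ d) :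
    HasDoubleIntegral (fun x y => Φ x y - Ψ x y) (c - d) :=
  ⟨hΦ.1.sub hΨ.1, (integral_sub hΦ.1 hΨ.1).trans (by rw [hΦ.2, hΨ.2])⟩

lemma sum {ι : Type*} {s : Finset ι} {Φ : ι → Ed n → Ed n → ℝ} {c : ι → ℝ}
    (hΦ : ∀ i, HasDoubleIntegral (Φ i) (c i)) :
    HasDoubleIntegral (fun x y => ∑ i ∈ s, Φ i x y) (∑ i ∈ s, c i) :=
  ⟨integrable_finsetSum _ fun i _ => (hΦ i).1,
    (integral_finsetSum _ fun i _ => (hΦ i).1).trans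
      (Finset.sum_congr rfl fun i _ => (hΦ i).2)⟩

lemma of_pairing {K f₁ f₂ : Ed n → ℝ} (hK : BddSmooth K) (h₁ : Integrable f₁)
    (h₂ : Integrable f₂) :
    HasDoubleIntegral (fun x y => K (x - y) * (f₁ x * f₂ y)) (pairing K f₁ f₂) :=
  ⟨integrable_pairing hK h₁ h₂, rfl⟩

lemma congr (hΦ : HasDoubleIntegral Φ c) (h : ∀ x y, Ψ x y = Φ x y) :
    HasDoubleIntegral Ψ c := by
  rwa [show Ψ = Φ from funext₂ h]

end HasDoubleIntegral

lemma integral_dens_mul_curr (hK : ∀ k, BddSmooth (pdR k h))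
    (hu : SmoothDecay fun p : ℝ × Ed n => u p.1 p.2)
    (hv : SmoothDecay fun p : ℝ × Ed n => v p.1 p.2) (t : ℝ) :
    (∫ x, ∫ y, dens u t x * ∑ k, pdR k h (x - y) * curr v k t y)
      = ∑ k, pairing (pdR k h) (dens u t) (curr v k t) :=
  ((HasDoubleIntegral.sum fun k => .of_pairing (hK k) (diffIntegrable_dens hu t).integrable
    (diffIntegrable_curr hv k t).integrable).congr fun x y => by
      rw [Finset.mul_sum]
      exact Finset.sum_congr rfl fun k _ => by ring).iterated_eq

lemma integral_mul_lapR_mul (hK : ∀ k, BddSmooth (pdR k h)) {f₁ f₂ : Ed n → ℝ}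
    (h₁ : Integrable f₁) (h₂ : Integrable f₂) :
    (∫ x, ∫ y, f₁ x * lapR h (x - y) * f₂ y) = ∑ k, pairing (hess h k k) f₁ f₂ :=
  ((HasDoubleIntegral.sum fun k => .of_pairing (bddSmooth_hess hK k k) h₁ h₂).congr
    fun x y => by
      rw [lapR, Finset.mul_sum, Finset.sum_mul]
      exact Finset.sum_congr rfl fun k _ => by rw [hess]; ring).iterated_eq

lemma integral_lapR_mul_grad_dens (hK : ∀ k, BddSmooth (pdR k h))
    (hu : SmoothDecay fun p : ℝ × Ed n => u p.1 p.2)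
    (hv : SmoothDecay fun p : ℝ × Ed n => v p.1 p.2) (t : ℝ) :
    (∫ x, ∫ y, lapR h (x - y) *
        ∑ k, pdR k (fun z => dens u t z) x * pdR k (fun z => dens v t z) y)
      = 4 * ∑ k, ∑ l, pairing (hess h k k) (reCurr u l t) (reCurr v l t) := by
  have h1 := HasDoubleIntegral.sum (s := Finset.univ) fun k : Fin n =>
    HasDoubleIntegral.sum (s := Finset.univ) fun l : Fin n =>
      HasDoubleIntegral.of_pairing (bddSmooth_hess hK k k)
        ((diffIntegrable_dens hu t).integrable_pdR l)
        ((diffIntegrable_dens hv t).integrable_pdR l)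
  have h2 := h1.congr (Ψ := fun x y => lapR h (x - y) *
      ∑ k, pdR k (fun z => dens u t z) x * pdR k (fun z => dens v t z) y) fun x y => by
    rw [lapR, Finset.sum_mul]
    refine Finset.sum_congr rfl fun k _ => ?_
    rw [Finset.mul_sum]
    rfl
  rw [h2.iterated_eq]
  simp only [pdR_dens hu, pdR_dens hv, pairing_const_mul_left, pairing_const_mul_right,
    Finset.mul_sum]
  refine Finset.sum_congr rfl fun k _ => Finset.sum_congr rfl fun l _ => by ring

lemma morawetzR2_eq (hK : ∀ k, BddSmooth (pdR k h))
    (hu : SmoothDecay fun p : ℝ × Ed n => u p.1 p.2)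
    (hv : SmoothDecay fun p : ℝ × Ed n => v p.1 p.2) (t : ℝ) :
    morawetzR2 h u v t = (1 / 2) * ∑ k, ∑ l,
      (pairing (hess h k l) (dens u t) (stress v k l t)
        + pairing (hess h k l) (stress u k l t) (dens v t)
        - pairing (hess h k l) (reCurr u l t) (reCurr v k t)
        - pairing (hess h k l) (curr u l t) (curr v k t)
        - pairing (hess h k l) (reCurr u k t) (reCurr v l t)
        - pairing (hess h k l) (curr u k t) (curr v l t)) := by
  have hH := bddSmooth_hess hK
  have hd {w : ℝ → Ed n → ℂ} (hw : SmoothDecay fun p : ℝ × Ed n => w p.1 p.2) :=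
    (diffIntegrable_dens hw t).integrable
  have ha {w : ℝ → Ed n → ℂ} (hw : SmoothDecay fun p : ℝ × Ed n => w p.1 p.2) (k : Fin n) :=
    (diffIntegrable_reCurr hw k t).integrable
  have hj {w : ℝ → Ed n → ℂ} (hw : SmoothDecay fun p : ℝ × Ed n => w p.1 p.2) (k : Fin n) :=
    (diffIntegrable_curr hw k t).integrable
  have hq {w : ℝ → Ed n → ℂ} (hw : SmoothDecay fun p : ℝ × Ed n => w p.1 p.2) (k l : Fin n) :=
    (diffIntegrable_stress hw k l t).integrable
  have h1 := HasDoubleIntegral.sum (s := Finset.univ) fun k : Fin n =>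
    HasDoubleIntegral.sum (s := Finset.univ) fun l : Fin n =>
      (((((HasDoubleIntegral.of_pairing (hH k l) (hd hu) (hq hv k l)).add
        (.of_pairing (hH k l) (hq hu k l) (hd hv))).sub
        (.of_pairing (hH k l) (ha hu l) (ha hv k))).sub
        (.of_pairing (hH k l) (hj hu l) (hj hv k))).sub
        (.of_pairing (hH k l) (ha hu k) (ha hv l))).sub
        (.of_pairing (hH k l) (hj hu k) (hj hv l))
  rw [morawetzR2]
  congr 1
  refine (h1.congr fun x y => ?_).iterated_eq
  simp only [Complex.re_sum, Complex.re_ofReal_mul]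
  refine Finset.sum_congr rfl fun k _ => Finset.sum_congr rfl fun l _ => ?_
  simp only [dens_eq_inner, curr_eq_inner, reCurr, stress, wVec2,
    Complex.real_inner_eq_re_mul_add_im_mul]
  simp
  ring

lemma morawetzR2_nonneg
    (hpos : ∀ (z : Ed n) (v : Fin n → ℝ), 0 ≤ ∑ k, ∑ l, hess h k l z * v k * v l)
    (u v : ℝ → Ed n → ℂ) (t : ℝ) : 0 ≤ morawetzR2 h u v t := by
  refine mul_nonneg (by norm_num) (integral_nonneg fun x => integral_nonneg fun y => ?_)
  have h1 := add_nonneg (hpos (x - y) fun k => (wVec2 u v t x y k).re)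
    (hpos (x - y) fun k => (wVec2 u v t x y k).im)
  simp only [← Finset.sum_add_distrib] at h1
  simp only [Pi.zero_apply, Complex.re_sum, Complex.re_ofReal_mul]
  refine h1.trans_eq (Finset.sum_congr rfl fun k _ => Finset.sum_congr rfl fun l _ => ?_)
  simp only [Complex.mul_re, Complex.conj_re, Complex.conj_im]
  ring

end Morawetz

/-- Bilinear Morawetz identity for two solutions of the same NLS
equation: with `M(t) = -(1/2)(⟨ρ₁,∇h⋆j₂⟩ + ⟨ρ₂,∇h⋆j₁⟩)`,
`M'(t) = (1/2){⟨∇ρ₁,Δh⋆∇ρ₂⟩ + ⟨ρ₁,Δh⋆(ρ₂g₂-G₂)⟩ + ⟨ρ₂,Δh⋆(ρ₁g₁-G₁)⟩} + R(t)`, and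
`R(t) ≥ 0` if the Hessian of `h` is everywhere positive semidefinite. -/
theorem nls_bilinear_morawetz_identity {n : ℕ} (hn : 1 ≤ n)
    (g G : ℝ → ℝ) (hg : ContDiff ℝ (⊤ : ℕ∞) g)
    (hG : ∀ r : ℝ, G r = ∫ s in (0:ℝ)..r, g s)
    (h : Ed n → ℝ) (hsmooth : ContDiff ℝ (⊤ : ℕ∞) h) (heven : ∀ x, h (-x) = h x)
    (hbdd : ∀ i : ℕ, 1 ≤ i → ∃ C : ℝ, ∀ x, ‖iteratedFDeriv ℝ i h x‖ ≤ C)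
    (u₁ u₂ : ℝ → Ed n → ℂ) (hu₁ : IsNLSSolution g u₁) (hu₂ : IsNLSSolution g u₂) :
    (∀ t : ℝ, HasDerivAt
      (fun s => -(1/2) * ((∫ x, ∫ y, dens u₁ s x * ∑ k, pdR k h (x - y) * curr u₂ k s y)
        + ∫ x, ∫ y, dens u₂ s x * ∑ k, pdR k h (x - y) * curr u₁ k s y))
      ((1/2) * ((∫ x, ∫ y, lapR h (x - y) *
            ∑ k, pdR k (fun z => dens u₁ t z) x * pdR k (fun z => dens u₂ t z) y)
          + (∫ x, ∫ y, dens u₁ t x * lapR h (x - y) *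
              (dens u₂ t y * g (dens u₂ t y) - G (dens u₂ t y)))
          + (∫ x, ∫ y, dens u₂ t x * lapR h (x - y) *
              (dens u₁ t y * g (dens u₁ t y) - G (dens u₁ t y))))
        + morawetzR2 h u₁ u₂ t) t) ∧
    ((∀ (z : Ed n) (v : Fin n → ℝ), 0 ≤ ∑ k, ∑ l, hess h k l z * v k * v l) →
      ∀ t : ℝ, 0 ≤ morawetzR2 h u₁ u₂ t) := by
  have hK := fun k => bddSmooth_pdR_of_bound hsmooth hbdd k
  refine ⟨fun t => ?_, fun hpos t => morawetzR2_nonneg hpos u₁ u₂ t⟩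
  have hS₁ := hu₁.smoothDecay
  have hS₂ := hu₂.smoothDecay
  have hswap (k l : Fin n) (f₁ f₂ : Ed n → ℝ) :
      pairing (hess h k l) f₁ f₂ = pairing (hess h k l) f₂ f₁ :=
    pairing_comm (hess_neg_of_even hsmooth heven k l) f₁ f₂
  have hdiff := (((hu₁.hasDerivAt_sum_pairing hsmooth hK hg hG hu₂ t).add
    (hu₂.hasDerivAt_sum_pairing hsmooth hK hg hG hu₁ t)).const_mul (-(1 / 2)))
  simp only [integral_dens_mul_curr hK hS₁ hS₂, integral_dens_mul_curr hK hS₂ hS₁]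
  refine hdiff.congr_deriv ?_
  have hP (u v : ℝ → Ed n → ℂ) (hu : IsNLSSolution g u) (hv : IsNLSSolution g v) :
      (∫ x, ∫ y, dens u t x * lapR h (x - y) *
        (dens v t y * g (dens v t y) - G (dens v t y)))
        = ∑ k, pairing (hess h k k) (dens u t) (pressure g G v t) :=
    integral_mul_lapR_mul hK (diffIntegrable_dens hu.smoothDecay t).integrable
      (diffIntegrable_pressure hv.smoothDecay hg hG t).integrable
  rw [hP u₁ u₂ hu₁ hu₂, hP u₂ u₁ hu₂ hu₁, integral_lapR_mul_grad_dens hK hS₁ hS₂,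
    morawetzR2_eq hK hS₁ hS₂]
  have hcurr (k l : Fin n) : pairing (hess h k l) (curr u₂ l t) (curr u₁ k t)
      = pairing (hess h k l) (curr u₁ k t) (curr u₂ l t) := hswap k l _ _
  have hre (k l : Fin n) : pairing (hess h k k) (reCurr u₂ l t) (reCurr u₁ l t)
      = pairing (hess h k k) (reCurr u₁ l t) (reCurr u₂ l t) := hswap k k _ _
  have hst (k l : Fin n) : pairing (hess h k l) (dens u₂ t) (stress u₁ k l t)
      = pairing (hess h k l) (stress u₁ k l t) (dens u₂ t) := hswap k l _ _
  have hre₁ : ∑ k, ∑ l, pairing (hess h k l) (reCurr u₁ l t) (reCurr u₂ k t)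
      = ∑ k, ∑ l, pairing (hess h k k) (reCurr u₁ l t) (reCurr u₂ l t) := by
    rw [Finset.sum_comm]
    exact Finset.sum_congr rfl fun k _ => Finset.sum_congr rfl fun l _ =>
      pairing_hess_reCurr hK hS₁ hS₂ l k t
  have hre₂ (k l : Fin n) : pairing (hess h k l) (reCurr u₁ k t) (reCurr u₂ l t)
      = pairing (hess h k k) (reCurr u₁ l t) (reCurr u₂ l t) := by
    rw [show hess h k l = hess h l k from pdR_comm hsmooth k l]
    exact pairing_hess_reCurr hK hS₁ hS₂ l k t
  simp only [hcurr, hre, hst, hre₂, Finset.sum_add_distrib, Finset.sum_sub_distrib]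
  rw [hre₁]
  ring
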